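/- Let f be a homogeneous polynomial of degree d ≥ 1 in n variables with real coefficients and let r ≥ d be an integer. Then f̲ − f_min^{(r−d)} ≤ (r^d / r^{(d)} − 1) · C(2d−1, d) · d^d · (f̄ − f̲), and f_{Δ(n,r)} − f̲ ≤ (1 − r^{(d)} / r^d) · C(2d−1, d) · d^d · (f̄ − f̲). -/

import Mathlib

open Finset

noncomputable section

/-- Falling factorial `t^(d) = t (t-1) ⋯ (t-d+1)`. -/
def fall (t : ℝ) : ℕ → ℝ
  | 0 => 1
  | d + 1 => fall t d * (t - (d : ℝ))

/-- The regular grid `Δ(n,r) = {x ∈ Δ_n : r·x ∈ ℕ^n}`. -/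
def regularGrid (n r : ℕ) : Set (Fin n → ℝ) :=
  {x ∈ stdSimplex ℝ (Fin n) | ∀ i, ∃ k : ℕ, (r : ℝ) * x i = (k : ℝ)}

/-- `f_{Δ(n,r)}`, the minimum of `f` over the regular grid. -/
def minGrid (n r : ℕ) (f : (Fin n → ℝ) → ℝ) : ℝ :=
  sInf (f '' regularGrid n r)

/-- `f̲`, the minimum of `f` over the standard simplex. -/
def minSimplex (n : ℕ) (f : (Fin n → ℝ) → ℝ) : ℝ :=
  sInf (f '' stdSimplex ℝ (Fin n))

/-- `f̄`, the maximum of `f` over the standard simplex. -/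
def maxSimplex (n : ℕ) (f : (Fin n → ℝ) → ℝ) : ℝ :=
  sSup (f '' stdSimplex ℝ (Fin n))

/-- The homogeneous polynomial of degree `d` with coefficients `c`,
`f(x) = Σ_{β ∈ I(n,d)} c_β x^β`. -/
def homPoly (n d : ℕ) (c : (Fin n → ℕ) → ℝ) (x : Fin n → ℝ) : ℝ :=
  ∑ β ∈ Finset.Nat.antidiagonalTuple n d, c β * ∏ i, x i ^ β i

/-- The Pólya-type lower bound
`f_min^{(r-d)} = min_{α ∈ I(n,r)} Σ_{β ∈ I(n,d)} c_β α^{(β)} / r^{(d)}`. -/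
def polyaBound (n d r : ℕ) (c : (Fin n → ℕ) → ℝ) : ℝ :=
  sInf ((fun α : Fin n → ℕ =>
      (∑ β ∈ Finset.Nat.antidiagonalTuple n d,
        c β * ∏ i, fall ((α i : ℕ) : ℝ) (β i)) / fall (r : ℝ) d) ''
    {α : Fin n → ℕ | ∑ i, α i = r})


lemma fall_nat (k m : ℕ) : fall (k : ℝ) m = (k.descFactorial m : ℝ) := by
  induction m with
  | zero => simp [fall]
  | succ m ih =>
    rw [fall, ih, Nat.descFactorial_succ]
    rcases le_or_gt m k with h | h
    · push_cast [Nat.cast_sub h]; ring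
    · rw [Nat.descFactorial_of_lt h]; simp

lemma multinomial_thm (n d : ℕ) (x : Fin n → ℝ) :
    ∑ β ∈ Finset.Nat.antidiagonalTuple n d,
      (Nat.multinomial univ β : ℝ) * ∏ i, x i ^ β i = (∑ i, x i) ^ d := by
  rw [Finset.sum_pow_eq_sum_piAntidiag]
  apply Finset.sum_congr _ (fun _ _ => rfl)
  ext β
  simp [Finset.Nat.mem_antidiagonalTuple, Finset.mem_piAntidiag]

lemma vandermonde_choose (n d : ℕ) (α : Fin n → ℕ) :
    ∑ β ∈ Finset.Nat.antidiagonalTuple n d, ∏ i, ((α i).choose (β i) : ℝ)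
      = ((∑ i, α i).choose d : ℝ) := by
  have h : ∏ i, ((1 + PowerSeries.X : PowerSeries ℝ) ^ α i)
      = (1 + PowerSeries.X : PowerSeries ℝ) ^ (∑ i, α i) :=
    Finset.prod_pow_eq_pow_sum _ _ _
  have hc : ∀ k m : ℕ, PowerSeries.coeff m ((1 + PowerSeries.X : PowerSeries ℝ) ^ k)
      = (k.choose m : ℝ) := by
    intro k m
    have : ((1 + PowerSeries.X : PowerSeries ℝ) ^ k)
      = (((1 + Polynomial.X : Polynomial ℝ) ^ k : Polynomial ℝ) : PowerSeries ℝ) := by simp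
    rw [this, Polynomial.coeff_coe, Polynomial.coeff_one_add_X_pow]
  have h2 := congrArg (PowerSeries.coeff d) h
  rw [PowerSeries.coeff_prod, hc] at h2
  rw [← h2]
  simp only [hc]
  refine Finset.sum_nbij' (fun β => Finsupp.equivFunOnFinite.symm β) (fun β => ⇑β) ?_ ?_ ?_ ?_ ?_
  · intro β hb
    simpa [Finset.Nat.mem_antidiagonalTuple, Finset.mem_finsuppAntidiag] using hb
  · intro β hb
    simpa [Finset.Nat.mem_antidiagonalTuple, Finset.mem_finsuppAntidiag] using hb
  · intro β hb; simp
  · intro β hb; ext; simp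
  · intro β hb; simp

lemma multinomial_mul (n d : ℕ) (β : Fin n → ℕ) (hb : ∑ i, β i = d) :
    (∏ i, ((β i).factorial : ℝ)) * (Nat.multinomial univ β : ℝ) = (d.factorial : ℝ) := by
  have := Nat.multinomial_spec univ β
  rw [hb] at this
  exact_mod_cast this

lemma vandermonde (n d r : ℕ) (α : Fin n → ℕ) (ha : ∑ i, α i = r) :
    ∑ β ∈ Finset.Nat.antidiagonalTuple n d,
      (Nat.multinomial univ β : ℝ) * ∏ i, fall ((α i : ℕ) : ℝ) (β i) = fall (r : ℝ) d := by
  rw [fall_nat, Nat.descFactorial_eq_factorial_mul_choose, Nat.cast_mul, ← ha,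
    ← vandermonde_choose, Finset.mul_sum]
  apply Finset.sum_congr rfl
  intro β hb
  rw [Finset.Nat.mem_antidiagonalTuple] at hb
  rw [← multinomial_mul n d β hb]
  simp only [fall_nat, Nat.descFactorial_eq_factorial_mul_choose, Nat.cast_mul,
    Finset.prod_mul_distrib]
  ring

lemma multinomial_moment (n d r : ℕ) (hr : d ≤ r) (x : Fin n → ℝ) (hx : ∑ i, x i = 1)
    (β : Fin n → ℕ) (hb : ∑ i, β i = d) :
    ∑ α ∈ Finset.Nat.antidiagonalTuple n r,
      ((Nat.multinomial univ α : ℝ) * ∏ i, x i ^ α i) * ∏ i, fall ((α i : ℕ) : ℝ) (β i)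
      = fall (r : ℝ) d * ∏ i, x i ^ β i := by
  have h1 := multinomial_thm n (r - d) x
  rw [hx, one_pow] at h1
  rw [← mul_one (fall (r : ℝ) d * ∏ i, x i ^ β i), ← h1, Finset.mul_sum]
  symm
  apply Finset.sum_of_injOn (fun γ => γ + β)
  · intro a _ b _ h; simpa using h
  · intro γ hg
    simp only [Finset.mem_coe, Finset.Nat.mem_antidiagonalTuple] at hg ⊢
    simp [Finset.sum_add_distrib, hg, hb]; omega
  · intro α ha hn
    rw [Finset.Nat.mem_antidiagonalTuple] at ha
    by_cases hle : ∀ i, β i ≤ α i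
    · exfalso
      apply hn
      refine ⟨α - β, ?_, ?_⟩
      · simp only [Finset.mem_coe, Finset.Nat.mem_antidiagonalTuple]
        have : ∑ i, α i = ∑ i, (α - β) i + ∑ i, β i := by
          rw [← Finset.sum_add_distrib]
          apply Finset.sum_congr rfl
          intro i _
          simp [Nat.sub_add_cancel (hle i)]
        omega
      · ext i; simp [Nat.sub_add_cancel (hle i)]
    · push Not at hle
      obtain ⟨i, hi⟩ := hle
      apply mul_eq_zero_of_right
      apply Finset.prod_eq_zero (Finset.mem_univ i)
      rw [fall_nat, Nat.descFactorial_of_lt hi]; simp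
  · intro γ hg
    rw [Finset.Nat.mem_antidiagonalTuple] at hg
    have hs : ∑ i, (γ + β) i = r := by simp [Finset.sum_add_distrib, hg, hb]; omega
    have m1 := multinomial_mul n (r - d) γ hg
    have m2 := multinomial_mul n r (γ + β) hs
    have hf : (r.factorial : ℝ) = ((r - d).factorial : ℝ) * fall (r : ℝ) d := by
      rw [fall_nat]; exact_mod_cast (Nat.factorial_mul_descFactorial hr).symm
    have hp : ∏ i, (((γ + β) i).factorial : ℝ)
        = (∏ i, ((γ i).factorial : ℝ)) * ∏ i, fall (((γ + β) i : ℕ) : ℝ) (β i) := by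
      rw [← Finset.prod_mul_distrib]
      apply Finset.prod_congr rfl
      intro i _
      rw [fall_nat]
      have := Nat.factorial_mul_descFactorial (n := (γ + β) i) (k := β i) (by simp)
      simp only [Pi.add_apply, Nat.add_sub_cancel] at this ⊢
      exact_mod_cast this.symm
    have hx2 : ∏ i, x i ^ (γ + β) i = (∏ i, x i ^ γ i) * ∏ i, x i ^ β i := by
      rw [← Finset.prod_mul_distrib]
      simp [pow_add]
    have hpos : (∏ i, ((γ i).factorial : ℝ)) ≠ 0 :=
      Finset.prod_ne_zero_iff.2 fun i _ => by positivity
    rw [hp] at m2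
    rw [hx2]
    have key : (Nat.multinomial univ (γ + β) : ℝ) * ∏ i, fall (((γ + β) i : ℕ) : ℝ) (β i)
        = fall (r : ℝ) d * (Nat.multinomial univ γ : ℝ) := by
      apply mul_left_cancel₀ hpos
      linear_combination m2 - fall (r : ℝ) d * m1 + hf
    linear_combination (-(∏ i, x i ^ γ i) * ∏ i, x i ^ β i) * key

lemma diff_pow (b e : ℕ) (h : e ≤ b) :
    ∑ k ∈ range (b + 1), ((-1 : ℝ) ^ (b - k) * (b.choose k : ℝ)) * (k : ℝ) ^ e
      = if e = b then (b.factorial : ℝ) else 0 := by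
  have h0 := fwdDiff_iter_eq_sum_shift (1 : ℝ) (fun r : ℝ => r ^ e) b 0
  have h1 : ∑ k ∈ range (b + 1), ((-1 : ℝ) ^ (b - k) * (b.choose k : ℝ)) * (k : ℝ) ^ e
      = (fwdDiff (1 : ℝ))^[b] (fun r : ℝ => r ^ e) 0 := by
    rw [h0]
    apply Finset.sum_congr rfl
    intro k _
    simp [zsmul_eq_mul]
  rw [h1]
  split_ifs with he
  · subst he
    rw [fwdDiff_iter_eq_factorial]; simp
  · rw [fwdDiff_iter_pow_eq_zero_of_lt (by omega)]; simp

/-- Inclusion-exclusion weights. -/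
def wt (n : ℕ) (β γ : Fin n → ℕ) : ℝ :=
  ∏ i, ((-1 : ℝ) ^ (β i - γ i) * ((β i).choose (γ i) : ℝ))

def box (n : ℕ) (β : Fin n → ℕ) : Finset (Fin n → ℕ) :=
  Fintype.piFinset fun i => range (β i + 1)

lemma wt_monomial (n : ℕ) (β δ : Fin n → ℕ) (h : ∑ i, δ i = ∑ i, β i) :
    ∑ γ ∈ box n β, wt n β γ * ∏ i, (γ i : ℝ) ^ δ i
      = if δ = β then ∏ i, ((β i).factorial : ℝ) else 0 := by
  have h1 : ∑ γ ∈ box n β, wt n β γ * ∏ i, (γ i : ℝ) ^ δ i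
      = ∏ i, ∑ k ∈ range (β i + 1),
        ((-1 : ℝ) ^ (β i - k) * ((β i).choose k : ℝ)) * (k : ℝ) ^ δ i := by
    rw [Finset.prod_univ_sum]
    apply Finset.sum_congr rfl
    intro γ _
    rw [wt, ← Finset.prod_mul_distrib]
  rw [h1]
  split_ifs with he
  · subst he
    apply Finset.prod_congr rfl
    intro i _
    rw [diff_pow _ _ le_rfl]; simp
  · have : ∃ i, δ i < β i := by
      by_contra hcon
      push Not at hcon
      apply he
      have := (Finset.sum_eq_sum_iff_of_le (s := univ) (fun i _ => hcon i)).1 h.symm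
      ext i
      exact (this i (Finset.mem_univ i)).symm
    obtain ⟨i, hi⟩ := this
    apply Finset.prod_eq_zero (Finset.mem_univ i)
    rw [diff_pow _ _ hi.le, if_neg hi.ne]

lemma wt_homPoly (n d : ℕ) (c : (Fin n → ℕ) → ℝ) (β : Fin n → ℕ) (hb : ∑ i, β i = d) :
    ∑ γ ∈ box n β, wt n β γ * homPoly n d c (fun i => (γ i : ℝ))
      = c β * ∏ i, ((β i).factorial : ℝ) := by
  simp only [homPoly, Finset.mul_sum]
  rw [Finset.sum_comm]
  have : ∀ δ ∈ Finset.Nat.antidiagonalTuple n d,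
      ∑ γ ∈ box n β, wt n β γ * (c δ * ∏ i, (γ i : ℝ) ^ δ i)
        = if δ = β then c β * ∏ i, ((β i).factorial : ℝ) else 0 := by
    intro δ hd
    rw [Finset.Nat.mem_antidiagonalTuple] at hd
    have := wt_monomial n β δ (hd.trans hb.symm)
    calc _ = c δ * ∑ γ ∈ box n β, wt n β γ * ∏ i, (γ i : ℝ) ^ δ i := by
          rw [Finset.mul_sum]
          exact Finset.sum_congr rfl fun _ _ => by ring
      _ = _ := by
          rw [this]
          split_ifs with he
          · rw [he]
          · simp
  rw [Finset.sum_congr rfl this, Finset.sum_ite_eq', if_pos]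
  rwa [Finset.Nat.mem_antidiagonalTuple]

lemma wt_abs_sum (n d : ℕ) (β : Fin n → ℕ) (hb : ∑ i, β i = d) :
    ∑ γ ∈ box n β, |wt n β γ| = 2 ^ d := by
  have h1 : ∑ γ ∈ box n β, |wt n β γ|
      = ∏ i, ∑ k ∈ range (β i + 1), ((β i).choose k : ℝ) := by
    rw [Finset.prod_univ_sum]
    apply Finset.sum_congr rfl
    intro γ _
    simp [wt, Finset.abs_prod, abs_mul]
  rw [h1, ← hb, ← Finset.prod_pow_eq_pow_sum]
  apply Finset.prod_congr rfl
  intro i _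
  exact_mod_cast Nat.sum_range_choose (β i)

lemma wt_sum (n d : ℕ) (hd : 1 ≤ d) (β : Fin n → ℕ) (hb : ∑ i, β i = d) :
    ∑ γ ∈ box n β, wt n β γ = 0 := by
  have h1 : ∑ γ ∈ box n β, wt n β γ
      = ∏ i, ∑ k ∈ range (β i + 1),
        ((-1 : ℝ) ^ (β i - k) * ((β i).choose k : ℝ)) * (k : ℝ) ^ 0 := by
    rw [Finset.prod_univ_sum]
    apply Finset.sum_congr rfl
    intro γ _
    simp [wt]
  rw [h1]
  have : ∃ i, 0 < β i := by
    by_contra hcon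
    push Not at hcon
    have : ∑ i, β i = 0 := Finset.sum_eq_zero fun i _ => by have := hcon i; omega
    omega
  obtain ⟨i, hi⟩ := this
  apply Finset.prod_eq_zero (Finset.mem_univ i)
  rw [diff_pow _ _ (Nat.zero_le _), if_neg (by omega)]

lemma homPoly_smul (n d : ℕ) (c : (Fin n → ℕ) → ℝ) (t : ℝ) (x : Fin n → ℝ) :
    homPoly n d c (fun i => t * x i) = t ^ d * homPoly n d c x := by
  simp only [homPoly, Finset.mul_sum]
  apply Finset.sum_congr rfl
  intro β hb
  rw [Finset.Nat.mem_antidiagonalTuple] at hb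
  simp only [mul_pow, Finset.prod_mul_distrib, Finset.prod_pow_eq_pow_sum, hb]
  ring

lemma two_pow_le (d : ℕ) (hd : 1 ≤ d) : 2 ^ d ≤ 2 * d.factorial := by
  induction d, hd using Nat.le_induction with
  | base => simp
  | succ m hm ih =>
    rw [pow_succ, Nat.factorial_succ]
    nlinarith [Nat.factorial_pos m]

/-- Nonnegative case of the bound on the Bernstein coefficients. -/
lemma coeff_bound_nonneg (n d : ℕ) (hd : 1 ≤ d) (c : (Fin n → ℕ) → ℝ) (M : ℝ) (hM : 0 ≤ M)
    (h0 : ∀ x ∈ stdSimplex ℝ (Fin n), 0 ≤ homPoly n d c x)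
    (h1 : ∀ x ∈ stdSimplex ℝ (Fin n), homPoly n d c x ≤ M)
    (β : Fin n → ℕ) (hb : ∑ i, β i = d) :
    c β ≤ (d : ℝ) ^ d * M * (Nat.multinomial univ β : ℝ) := by
  have hD : 0 ≤ (d : ℝ) ^ d * M := by positivity
  have hval : ∀ γ ∈ box n β, 0 ≤ homPoly n d c (fun i => (γ i : ℝ)) ∧
      homPoly n d c (fun i => (γ i : ℝ)) ≤ (d : ℝ) ^ d * M := by
    intro γ hg
    have hle : ∀ i, γ i ≤ β i := by
      intro i
      have := (Fintype.mem_piFinset.1 hg) i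
      simp at this; omega
    have hs : ∑ i, γ i ≤ d := hb ▸ Finset.sum_le_sum fun i _ => hle i
    set s := ∑ i, γ i with hsd
    have hsr : (s : ℝ) = ∑ i, (γ i : ℝ) := by rw [hsd]; push_cast; rfl
    rcases Nat.eq_zero_or_pos s with h | h
    · have hz : ∀ i, γ i = 0 := by
        intro i
        exact (Finset.sum_eq_zero_iff.1 (hsd ▸ h)) i (Finset.mem_univ i)
      have : homPoly n d c (fun i => (γ i : ℝ)) = 0 := by
        have := homPoly_smul n d c 0 (fun i => (γ i : ℝ))
        rw [zero_pow (by omega), zero_mul] at this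
        rw [← this]; congr 1; ext i; simp [hz i]
      rw [this]; exact ⟨le_rfl, hD⟩
    · have hsp : (0 : ℝ) < s := by exact_mod_cast h
      have hmem : (fun i => (γ i : ℝ) / s) ∈ stdSimplex ℝ (Fin n) := by
        refine ⟨fun i => by positivity, ?_⟩
        rw [← Finset.sum_div, ← hsr, div_self hsp.ne']
      have heq : homPoly n d c (fun i => (γ i : ℝ))
          = (s : ℝ) ^ d * homPoly n d c (fun i => (γ i : ℝ) / s) := by
        rw [← homPoly_smul]
        congr 1; ext i; field_simp
      rw [heq]
      have a := h0 _ hmem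
      have b := h1 _ hmem
      refine ⟨by positivity, ?_⟩
      have : (s : ℝ) ≤ d := by exact_mod_cast hs
      gcongr
  have hfac : (0 : ℝ) < ∏ i, ((β i).factorial : ℝ) :=
    Finset.prod_pos fun i _ => by positivity
  have key : c β * ∏ i, ((β i).factorial : ℝ) ≤ (d : ℝ) ^ d * M * d.factorial := by
    rw [← wt_homPoly n d c β hb]
    calc _ ≤ ∑ γ ∈ box n β, ((|wt n β γ| + wt n β γ) / 2) * ((d : ℝ) ^ d * M) := by
          apply Finset.sum_le_sum
          intro γ hg
          obtain ⟨a, b⟩ := hval γ hg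
          have p1 := le_abs_self (wt n β γ)
          have p2 := neg_abs_le (wt n β γ)
          calc _ ≤ ((|wt n β γ| + wt n β γ) / 2) * homPoly n d c (fun i => (γ i : ℝ)) :=
                mul_le_mul_of_nonneg_right (by linarith) a
            _ ≤ _ := mul_le_mul_of_nonneg_left b (by linarith)
      _ = (2 ^ d / 2) * ((d : ℝ) ^ d * M) := by
          rw [← Finset.sum_mul, ← Finset.sum_div, Finset.sum_add_distrib,
            wt_abs_sum n d β hb, wt_sum n d hd β hb, add_zero]
      _ ≤ _ := by
          rw [mul_comm]
          have : (2 : ℝ) ^ d ≤ 2 * d.factorial := by exact_mod_cast two_pow_le d hd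
          exact mul_le_mul_of_nonneg_left (by linarith) hD
  rw [← multinomial_mul n d β hb] at key
  refine le_of_mul_le_mul_right ?_ hfac
  linarith

lemma coeff_bound (n d : ℕ) (hd : 1 ≤ d) (c : (Fin n → ℕ) → ℝ) (m M : ℝ) (hM : m ≤ M)
    (h0 : ∀ x ∈ stdSimplex ℝ (Fin n), m ≤ homPoly n d c x)
    (h1 : ∀ x ∈ stdSimplex ℝ (Fin n), homPoly n d c x ≤ M)
    (β : Fin n → ℕ) (hb : ∑ i, β i = d) :
    c β ≤ (m + (d : ℝ) ^ d * (M - m)) * (Nat.multinomial univ β : ℝ) := by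
  have hp : ∀ x ∈ stdSimplex ℝ (Fin n),
      homPoly n d (fun β => c β - m * (Nat.multinomial univ β : ℝ)) x = homPoly n d c x - m := by
    intro x hx
    have := multinomial_thm n d x
    rw [hx.2, one_pow] at this
    have e : homPoly n d c x - m = homPoly n d c x - m * 1 := by ring
    rw [e, ← this]
    simp only [homPoly, Finset.mul_sum]
    rw [← Finset.sum_sub_distrib]
    exact Finset.sum_congr rfl fun _ _ => by ring
  have := coeff_bound_nonneg n d hd (fun β => c β - m * (Nat.multinomial univ β : ℝ)) (M - m)
    (by linarith) (fun x hx => by rw [hp x hx]; linarith [h0 x hx])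
    (fun x hx => by rw [hp x hx]; linarith [h1 x hx]) β hb
  linarith

/-- The key comparison between powers and falling factorials. -/
lemma pow_sub_fall (n d r : ℕ) (c : (Fin n → ℕ) → ℝ) (B : ℝ)
    (hB : ∀ β : Fin n → ℕ, ∑ i, β i = d → c β ≤ B * (Nat.multinomial univ β : ℝ))
    (α : Fin n → ℕ) (ha : ∑ i, α i = r) :
    homPoly n d c (fun i => (α i : ℝ)) -
      ∑ β ∈ Finset.Nat.antidiagonalTuple n d, c β * ∏ i, fall ((α i : ℕ) : ℝ) (β i)
      ≤ B * ((r : ℝ) ^ d - fall (r : ℝ) d) := by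
  have e1 := multinomial_thm n d (fun i => (α i : ℝ))
  have e2 := vandermonde n d r α ha
  have e3 : ∑ i, (α i : ℝ) = (r : ℝ) := by exact_mod_cast ha
  rw [e3] at e1
  rw [← e1, ← e2, homPoly, ← Finset.sum_sub_distrib, ← Finset.sum_sub_distrib, Finset.mul_sum]
  apply Finset.sum_le_sum
  intro β hb
  rw [Finset.Nat.mem_antidiagonalTuple] at hb
  have : ∏ i, fall ((α i : ℕ) : ℝ) (β i) ≤ ∏ i, (α i : ℝ) ^ β i := by
    apply Finset.prod_le_prod
    · intro i _; rw [fall_nat]; positivity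
    · intro i _; rw [fall_nat]; exact_mod_cast Nat.descFactorial_le_pow (α i) (β i)
  nlinarith [hB β hb, mul_le_mul_of_nonneg_right (hB β hb) (sub_nonneg.2 this)]

lemma homPoly_continuous (n d : ℕ) (c : (Fin n → ℕ) → ℝ) : Continuous (homPoly n d c) := by
  unfold homPoly
  fun_prop

theorem statement14 (n d r : ℕ) (hn : 0 < n) (hd : 1 ≤ d) (hr : d ≤ r)
    (c : (Fin n → ℕ) → ℝ) :
    minSimplex n (homPoly n d c) - polyaBound n d r c ≤
        ((r : ℝ) ^ d / fall (r : ℝ) d - 1) * (Nat.choose (2 * d - 1) d : ℝ) * (d : ℝ) ^ d *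
          (maxSimplex n (homPoly n d c) - minSimplex n (homPoly n d c)) ∧
      minGrid n r (homPoly n d c) - minSimplex n (homPoly n d c) ≤
        (1 - fall (r : ℝ) d / (r : ℝ) ^ d) * (Nat.choose (2 * d - 1) d : ℝ) * (d : ℝ) ^ d *
          (maxSimplex n (homPoly n d c) - minSimplex n (homPoly n d c)) := by
  have hcomp : IsCompact (homPoly n d c '' stdSimplex ℝ (Fin n)) :=
    (isCompact_stdSimplex ℝ (Fin n)).image (homPoly_continuous n d c)
  have hne : (stdSimplex ℝ (Fin n)).Nonempty := ⟨_, single_mem_stdSimplex ℝ (⟨0, hn⟩ : Fin n)⟩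
  have hmin : ∀ x ∈ stdSimplex ℝ (Fin n), minSimplex n (homPoly n d c) ≤ homPoly n d c x :=
    fun x hx => csInf_le hcomp.bddBelow ⟨x, hx, rfl⟩
  have hmax : ∀ x ∈ stdSimplex ℝ (Fin n), homPoly n d c x ≤ maxSimplex n (homPoly n d c) :=
    fun x hx => le_csSup hcomp.bddAbove ⟨x, hx, rfl⟩
  obtain ⟨x, hx, hxm⟩ : minSimplex n (homPoly n d c) ∈ homPoly n d c '' stdSimplex ℝ (Fin n) :=
    hcomp.sInf_mem (hne.image _)
  set m := minSimplex n (homPoly n d c)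
  set M := maxSimplex n (homPoly n d c)
  have hmM : m ≤ M := (hmin x hx).trans (hmax x hx)
  have hB := coeff_bound n d hd c m M hmM hmin hmax
  set F := fall (r : ℝ) d with hF
  have hFpos : 0 < F := by
    rw [hF, fall_nat]
    exact_mod_cast Nat.descFactorial_pos.2 hr
  have hFle : F ≤ (r : ℝ) ^ d := by
    rw [hF, fall_nat]; exact_mod_cast Nat.descFactorial_le_pow r d
  have hrpos : (0 : ℝ) < (r : ℝ) := by exact_mod_cast (by omega : 0 < r)
  have hrd : (0 : ℝ) < (r : ℝ) ^ d := by positivity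
  have hC : (1 : ℝ) ≤ (Nat.choose (2 * d - 1) d : ℝ) := by
    exact_mod_cast Nat.choose_pos (by omega)
  set C : ℝ := (Nat.choose (2 * d - 1) d : ℝ)
  have hDnn : 0 ≤ (d : ℝ) ^ d * (M - m) := mul_nonneg (by positivity) (by linarith)
  have hweak : ∀ t : ℝ, 0 ≤ t → t * ((d : ℝ) ^ d * (M - m)) ≤ t * C * (d : ℝ) ^ d * (M - m) := by
    intro t ht
    have := mul_nonneg (mul_nonneg ht (sub_nonneg.2 hC)) hDnn
    linarith
  have hmemα : ∀ α : Fin n → ℕ, ∑ i, α i = r →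
      (fun i => (α i : ℝ) / r) ∈ stdSimplex ℝ (Fin n) := by
    intro α ha
    refine ⟨fun i => by positivity, ?_⟩
    rw [← Finset.sum_div, div_eq_one_iff_eq hrpos.ne']
    exact_mod_cast ha
  have hscale : ∀ α : Fin n → ℕ, homPoly n d c (fun i => (α i : ℝ))
      = (r : ℝ) ^ d * homPoly n d c (fun i => (α i : ℝ) / r) := by
    intro α
    rw [← homPoly_smul]
    congr 1; ext i; field_simp
  constructor
  · refine le_trans ?_ (hweak _ (by rw [sub_nonneg, one_le_div hFpos]; exact hFle))
    rw [sub_le_comm]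
    apply le_csInf
    · refine Set.Nonempty.image _ ⟨Pi.single ⟨0, hn⟩ r, ?_⟩
      simp
    · rintro _ ⟨α, ha, rfl⟩
      have ha' : ∑ i, α i = r := ha
      have k := pow_sub_fall n d r c _ hB α ha'
      rw [hscale] at k
      have k2 := mul_le_mul_of_nonneg_left (hmin _ (hmemα α ha')) hrd.le
      simp only
      rw [le_div_iff₀ hFpos]
      have e : (m - ((r : ℝ) ^ d / F - 1) * ((d : ℝ) ^ d * (M - m))) * F
          = m * F - ((r : ℝ) ^ d - F) * ((d : ℝ) ^ d * (M - m)) := by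
        field_simp
      rw [e]
      linarith
  · refine le_trans ?_ (hweak _ (by rw [sub_nonneg, div_le_one hrd]; exact hFle))
    have hgb : BddBelow (homPoly n d c '' regularGrid n r) :=
      hcomp.bddBelow.mono (Set.image_mono fun y hy => hy.1)
    have hg : ∀ α : Fin n → ℕ, ∑ i, α i = r →
        minGrid n r (homPoly n d c) ≤ homPoly n d c (fun i => (α i : ℝ) / r) := by
      intro α ha
      apply csInf_le hgb
      exact ⟨_, ⟨hmemα α ha, fun i => ⟨α i, by field_simp⟩⟩, rfl⟩
    set g := minGrid n r (homPoly n d c)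
    set p : (Fin n → ℕ) → ℝ := fun α => (Nat.multinomial univ α : ℝ) * ∏ i, x i ^ α i with hp
    have hp0 : ∀ α, 0 ≤ p α := fun α =>
      mul_nonneg (by positivity) (Finset.prod_nonneg fun i _ => pow_nonneg (hx.1 i) _)
    have hp1 : ∑ α ∈ Finset.Nat.antidiagonalTuple n r, p α = 1 := by
      rw [hp, multinomial_thm, hx.2, one_pow]
    have hE : ∑ α ∈ Finset.Nat.antidiagonalTuple n r, p α *
        ∑ β ∈ Finset.Nat.antidiagonalTuple n d, c β * ∏ i, fall ((α i : ℕ) : ℝ) (β i)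
        = F * m := by
      simp only [Finset.mul_sum]
      rw [Finset.sum_comm, ← hxm, homPoly, Finset.mul_sum]
      apply Finset.sum_congr rfl
      intro β hb
      rw [Finset.Nat.mem_antidiagonalTuple] at hb
      have := multinomial_moment n d r hr x hx.2 β hb
      calc _ = c β * ∑ α ∈ Finset.Nat.antidiagonalTuple n r,
            p α * ∏ i, fall ((α i : ℕ) : ℝ) (β i) := by
            rw [Finset.mul_sum]
            exact Finset.sum_congr rfl fun _ _ => by ring
        _ = _ := by rw [hp, this]; ring
    set B := m + (d : ℝ) ^ d * (M - m) with hBdef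
    have hfin : (r : ℝ) ^ d * g ≤ F * m + B * ((r : ℝ) ^ d - F) := by
      calc (r : ℝ) ^ d * g = ∑ α ∈ Finset.Nat.antidiagonalTuple n r, p α * ((r : ℝ) ^ d * g) := by
            rw [← Finset.sum_mul, hp1, one_mul]
        _ ≤ ∑ α ∈ Finset.Nat.antidiagonalTuple n r, (p α *
              (∑ β ∈ Finset.Nat.antidiagonalTuple n d, c β * ∏ i, fall ((α i : ℕ) : ℝ) (β i))
              + p α * (B * ((r : ℝ) ^ d - F))) := by
            apply Finset.sum_le_sum
            intro α ha
            rw [Finset.Nat.mem_antidiagonalTuple] at ha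
            rw [← mul_add]
            apply mul_le_mul_of_nonneg_left _ (hp0 α)
            have k := pow_sub_fall n d r c _ hB α ha
            rw [hscale] at k
            have k2 := mul_le_mul_of_nonneg_left (hg α ha) hrd.le
            linarith
        _ = _ := by rw [Finset.sum_add_distrib, hE, ← Finset.sum_mul, hp1, one_mul]
    refine le_of_mul_le_mul_left ?_ hrd
    have e : (r : ℝ) ^ d * ((1 - F / (r : ℝ) ^ d) * ((d : ℝ) ^ d * (M - m)))
        = ((r : ℝ) ^ d - F) * ((d : ℝ) ^ d * (M - m)) := by
      field_simp
    rw [e]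
    rw [hBdef] at hfin
    linarith
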